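/- arXiv:1508.07891 — 6 statements merged into one kernel-verified Lean document; each statement's English description precedes it below -/
import Mathlib

section
/- Suppose σᵇ, σᵃ, ρ : ℝ → ℝ are continuous on [0,1], ν(z) > 0 for all z ∈ [0,1], and let H ∈ (0,1). Define u_H(z) = H + (1-2H)·(∫₀^z exp(-∫₀^y μ(x)/ν(x) dx) dy) / (∫₀^1 exp(-∫₀^y μ(x)/ν(x) dx) dy). Then u_H(0) = H, u_H(1) = 1 - H, and u_H is twice differentiable on (0,1) with ν(z)·u_H''(z) + μ(z)·u_H'(z) = 0 for every z ∈ (0,1). (This is the analytic content of Theorem 3.3, incorporating hidden liquidity H.) -/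
open Real Set

/-- Drift coefficient μ(z) of the imbalance ODE. -/
noncomputable def mu (σb σa ρ : ℝ → ℝ) (z : ℝ) : ℝ :=
  -2 * (1 - z) * (σb z) ^ 2 + 2 * (2 * z - 1) * ρ z * σb z * σa z + 2 * z * (σa z) ^ 2

/-- Diffusion coefficient ν(z) of the imbalance ODE. -/
noncomputable def nu (σb σa ρ : ℝ → ℝ) (z : ℝ) : ℝ :=
  (1 - z) ^ 2 * (σb z) ^ 2 - 2 * z * (1 - z) * ρ z * σb z * σa z + z ^ 2 * (σa z) ^ 2

theorem hasDerivAt_integral_of_continuousOn_Icc {f : ℝ → ℝ} {a b z : ℝ}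
    (hf : ContinuousOn f (Icc a b)) (hz : z ∈ Ioo a b) :
    HasDerivAt (fun y => ∫ x in a..y, f x) (f z) z := by
  have hsub : uIcc a z ⊆ Icc a b := by
    rw [uIcc_of_le hz.1.le]
    exact Icc_subset_Icc_right hz.2.le
  exact intervalIntegral.integral_hasDerivAt_right (hf.mono hsub).intervalIntegrable
    ((hf.mono Ioo_subset_Icc_self).stronglyMeasurableAtFilter isOpen_Ioo z hz)
    (hf.continuousAt (Icc_mem_nhds hz.1 hz.2))

/-- The scale density `exp (-∫ₐ^y f)` is continuous on `[a, b]` when `f` is. -/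
theorem continuousOn_exp_neg_integral {f : ℝ → ℝ} {a b : ℝ} (hab : a ≤ b)
    (hf : ContinuousOn f (Icc a b)) :
    ContinuousOn (fun y => Real.exp (-∫ x in a..y, f x)) (Icc a b) := by
  have h := intervalIntegral.continuousOn_primitive_interval (μ := MeasureTheory.volume)
    (f := f) (a := a) (b := b) (by
      rw [uIcc_of_le hab]
      exact hf.integrableOn_Icc)
  rw [uIcc_of_le hab] at h
  exact h.neg.rexp

theorem continuousOn_mu_div_nu {σb σa ρ : ℝ → ℝ}
    (hσb : ContinuousOn σb (Icc 0 1)) (hσa : ContinuousOn σa (Icc 0 1))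
    (hρ : ContinuousOn ρ (Icc 0 1)) (hν : ∀ z ∈ Icc (0:ℝ) 1, 0 < nu σb σa ρ z) :
    ContinuousOn (fun z => mu σb σa ρ z / nu σb σa ρ z) (Icc 0 1) := by
  refine ContinuousOn.div ?_ ?_ fun z hz => (hν z hz).ne'
  · unfold mu
    fun_prop
  · unfold nu
    fun_prop

theorem stmt_1 (σb σa ρ : ℝ → ℝ)
    (hσb : ContinuousOn σb (Icc 0 1))
    (hσa : ContinuousOn σa (Icc 0 1))
    (hρ : ContinuousOn ρ (Icc 0 1))
    (hν : ∀ z ∈ Icc (0:ℝ) 1, 0 < nu σb σa ρ z)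
    (H : ℝ) (hH : H ∈ Ioo (0:ℝ) 1)
    (uH : ℝ → ℝ)
    (huH : ∀ z : ℝ, uH z = H + (1 - 2 * H) *
      ((∫ y in (0:ℝ)..z, Real.exp (-∫ x in (0:ℝ)..y, mu σb σa ρ x / nu σb σa ρ x)) /
       (∫ y in (0:ℝ)..(1:ℝ), Real.exp (-∫ x in (0:ℝ)..y, mu σb σa ρ x / nu σb σa ρ x)))) :
    uH 0 = H ∧ uH 1 = 1 - H ∧
    ∀ z ∈ Ioo (0:ℝ) 1, DifferentiableAt ℝ uH z ∧ DifferentiableAt ℝ (deriv uH) z ∧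
      nu σb σa ρ z * deriv (deriv uH) z + mu σb σa ρ z * deriv uH z = 0 := by
  have hf := continuousOn_mu_div_nu hσb hσa hρ hν
  set f : ℝ → ℝ := fun z => mu σb σa ρ z / nu σb σa ρ z
  set g : ℝ → ℝ := fun y => Real.exp (-∫ x in (0:ℝ)..y, f x)
  have hg : ContinuousOn g (Icc 0 1) := continuousOn_exp_neg_integral zero_le_one hf
  set I : ℝ := ∫ y in (0:ℝ)..1, g y with hI
  have hIpos : 0 < I :=
    intervalIntegral.intervalIntegral_pos_of_pos_on
      (hg.intervalIntegrable_of_Icc zero_le_one) (fun _ _ => Real.exp_pos _) one_pos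
  have hu : ∀ z, uH z = H + (1 - 2 * H) * ((∫ y in (0:ℝ)..z, g y) / I) := huH
  have hu' : ∀ z ∈ Ioo (0:ℝ) 1, HasDerivAt uH ((1 - 2 * H) * (g z / I)) z := by
    intro z hz
    rw [funext hu]
    exact (((hasDerivAt_integral_of_continuousOn_Icc hg hz).div_const I).const_mul _).const_add H
  refine ⟨by simp [hu], ?_, fun z hz => ?_⟩
  · rw [hu, ← hI, div_self hIpos.ne']
    ring
  have hg' : HasDerivAt g (g z * -f z) z :=
    (hasDerivAt_integral_of_continuousOn_Icc hf hz).neg.exp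
  have hderiv : deriv uH =ᶠ[nhds z] fun y => (1 - 2 * H) * (g y / I) := by
    filter_upwards [isOpen_Ioo.mem_nhds hz] with y hy using (hu' y hy).deriv
  have hu'' : HasDerivAt (deriv uH) ((1 - 2 * H) * (g z * -f z / I)) z :=
    ((hg'.div_const I).const_mul _).congr_of_eventuallyEq hderiv
  refine ⟨(hu' z hz).differentiableAt, hu''.differentiableAt, ?_⟩
  rw [hu''.deriv, (hu' z hz).deriv]
  have hνz : nu σb σa ρ z * f z = mu σb σa ρ z :=
    mul_div_cancel₀ _ (hν z (Ioo_subset_Icc_self hz)).ne'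
  rw [← hνz]
  ring
end

section
/- Let σ > 0 be a constant and set σᵇ(z) = σᵃ(z) = σ and ρ(z) = 0 for all z. Then μ(z) = -2(1-2z)·σ² and ν(z) = (1 - 2z + 2z²)·σ², and the formula u(z) = (∫₀^z exp(-∫₀^y μ(x)/ν(x) dx) dy) / (∫₀^1 exp(-∫₀^y μ(x)/ν(x) dx) dy) satisfies u(z) = (π/4 + arctan(2z-1)) / (π/2) for all z ∈ [0,1]; in particular, for z ∈ [0,1), u(z) = (2/π)·arctan(z/(1-z)). (Recovers the zero-correlation case of Avellaneda et al.) -/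
open Real Set

theorem one_sub_two_mul_add_pos (z : ℝ) : 0 < 1 - 2 * z + 2 * z ^ 2 := by
  nlinarith [sq_nonneg (2 * z - 1)]

theorem mu_const (σ z : ℝ) :
    mu (fun _ => σ) (fun _ => σ) (fun _ => 0) z = -2 * (1 - 2 * z) * σ ^ 2 := by
  unfold mu
  ring

theorem nu_const (σ z : ℝ) :
    nu (fun _ => σ) (fun _ => σ) (fun _ => 0) z = (1 - 2 * z + 2 * z ^ 2) * σ ^ 2 := by
  unfold nu
  ring

theorem integral_mu_div_nu_const {σ : ℝ} (hσ : σ ≠ 0) (y : ℝ) :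
    ∫ x in (0 : ℝ)..y, mu (fun _ => σ) (fun _ => σ) (fun _ => 0) x /
      nu (fun _ => σ) (fun _ => σ) (fun _ => 0) x = Real.log (1 - 2 * y + 2 * y ^ 2) := by
  have hratio : ∀ x : ℝ, mu (fun _ => σ) (fun _ => σ) (fun _ => 0) x /
      nu (fun _ => σ) (fun _ => σ) (fun _ => 0) x = (4 * x - 2) / (1 - 2 * x + 2 * x ^ 2) := by
    intro x
    rw [mu_const, nu_const, mul_div_mul_right _ _ (pow_ne_zero 2 hσ)]
    ring
  have hderiv : ∀ x : ℝ, HasDerivAt (fun x : ℝ => Real.log (1 - 2 * x + 2 * x ^ 2))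
      ((4 * x - 2) / (1 - 2 * x + 2 * x ^ 2)) x := by
    intro x
    refine HasDerivAt.log ?_ (one_sub_two_mul_add_pos x).ne'
    refine ((((hasDerivAt_id' x).const_mul 2).const_sub 1).add
      ((hasDerivAt_pow 2 x).const_mul 2)).congr_deriv ?_
    norm_num
    ring
  have hcont : Continuous fun x : ℝ => (4 * x - 2) / (1 - 2 * x + 2 * x ^ 2) :=
    Continuous.div (by fun_prop) (by fun_prop) fun x => (one_sub_two_mul_add_pos x).ne'
  simp_rw [hratio]
  rw [intervalIntegral.integral_eq_sub_of_hasDerivAt (fun x _ => hderiv x)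
    (hcont.intervalIntegrable 0 y)]
  simp

theorem integral_inv_one_sub_two_mul_add (z : ℝ) :
    ∫ y in (0 : ℝ)..z, (1 - 2 * y + 2 * y ^ 2)⁻¹ = π / 4 + Real.arctan (2 * z - 1) := by
  have hderiv : ∀ y : ℝ, HasDerivAt (fun y : ℝ => Real.arctan (2 * y - 1))
      (1 - 2 * y + 2 * y ^ 2)⁻¹ y := by
    intro y
    convert (((hasDerivAt_id' y).const_mul 2).sub_const 1).arctan using 1
    have h₁ := (one_sub_two_mul_add_pos y).ne'
    have h₂ : 1 + (2 * y - 1) ^ 2 = 2 * (1 - 2 * y + 2 * y ^ 2) := by ring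
    rw [h₂]
    field_simp
  have hcont : Continuous fun y : ℝ => (1 - 2 * y + 2 * y ^ 2)⁻¹ :=
    Continuous.inv₀ (by fun_prop) fun y => (one_sub_two_mul_add_pos y).ne'
  rw [intervalIntegral.integral_eq_sub_of_hasDerivAt (fun y _ => hderiv y)
    (hcont.intervalIntegrable 0 z)]
  norm_num [Real.arctan_neg, Real.arctan_one]
  ring

theorem pi_div_four_add_arctan {z : ℝ} (hz : z < 1) :
    π / 4 + Real.arctan (2 * z - 1) = Real.arctan (z / (1 - z)) := by
  rw [← Real.arctan_one, Real.arctan_add (by linarith)]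
  congr 1
  have h : 1 - z ≠ 0 := by linarith
  rw [show 1 + (2 * z - 1) = 2 * z by ring, show 1 - 1 * (2 * z - 1) = 2 * (1 - z) by ring,
    mul_div_mul_left _ _ two_ne_zero]

theorem stmt_4 (σ : ℝ) (hσ : 0 < σ)
    (u : ℝ → ℝ)
    (hu : ∀ z : ℝ, u z =
      (∫ y in (0:ℝ)..z, Real.exp
        (-∫ x in (0:ℝ)..y,
          mu (fun _ => σ) (fun _ => σ) (fun _ => 0) x /
          nu (fun _ => σ) (fun _ => σ) (fun _ => 0) x)) /
      (∫ y in (0:ℝ)..(1:ℝ), Real.exp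
        (-∫ x in (0:ℝ)..y,
          mu (fun _ => σ) (fun _ => σ) (fun _ => 0) x /
          nu (fun _ => σ) (fun _ => σ) (fun _ => 0) x))) :
    (∀ z : ℝ, mu (fun _ => σ) (fun _ => σ) (fun _ => 0) z = -2 * (1 - 2 * z) * σ ^ 2 ∧
      nu (fun _ => σ) (fun _ => σ) (fun _ => 0) z = (1 - 2 * z + 2 * z ^ 2) * σ ^ 2) ∧
    (∀ z ∈ Icc (0:ℝ) 1, u z = (π / 4 + Real.arctan (2 * z - 1)) / (π / 2)) ∧
    (∀ z ∈ Ico (0:ℝ) 1, u z = (2 / π) * Real.arctan (z / (1 - z))) := by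
  have hexp : ∀ y : ℝ, Real.exp (-∫ x in (0 : ℝ)..y,
      mu (fun _ => σ) (fun _ => σ) (fun _ => 0) x /
      nu (fun _ => σ) (fun _ => σ) (fun _ => 0) x) = (1 - 2 * y + 2 * y ^ 2)⁻¹ := by
    intro y
    rw [integral_mu_div_nu_const hσ.ne', Real.exp_neg, Real.exp_log (one_sub_two_mul_add_pos y)]
  have hformula : ∀ z : ℝ, u z = (π / 4 + Real.arctan (2 * z - 1)) / (π / 2) := by
    intro z
    rw [hu]
    simp_rw [hexp]
    rw [integral_inv_one_sub_two_mul_add, integral_inv_one_sub_two_mul_add,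
      show (2 * 1 - 1 : ℝ) = 1 by norm_num, Real.arctan_one, show π / 4 + π / 4 = π / 2 by ring]
  refine ⟨fun z => ⟨mu_const σ z, nu_const σ z⟩, fun z _ => hformula z, fun z hz => ?_⟩
  rw [hformula, pi_div_four_add_arctan hz.2]
  field_simp
end

section
/- If σᵇ, σᵃ, ρ : ℝ → ℝ are constant functions, then μ(z) = ν'(z) for all z ∈ ℝ; consequently, if in addition ν(z) > 0 on [0,1], the formula u(z) = (∫₀^z exp(-∫₀^y μ(x)/ν(x) dx) dy) / (∫₀^1 exp(-∫₀^y μ(x)/ν(x) dx) dy) simplifies to u(z) = (∫₀^z 1/ν(y) dy) / (∫₀^1 1/ν(y) dy) for all z ∈ [0,1]. -/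
open Real Set

theorem hasDerivAt_nu_const (cb ca cρ z : ℝ) :
    HasDerivAt (nu (fun _ => cb) (fun _ => ca) (fun _ => cρ))
      (mu (fun _ => cb) (fun _ => ca) (fun _ => cρ) z) z := by
  have h1 : HasDerivAt (fun x : ℝ => 1 - x) (-1) z := by
    simpa using (hasDerivAt_id z).const_sub 1
  have h2 : HasDerivAt (fun x : ℝ => x) 1 z := hasDerivAt_id z
  have h := (((h1.pow 2).mul_const (cb ^ 2)).sub
    ((h2.mul h1).mul_const (2 * cρ * cb * ca))).add ((h2.pow 2).mul_const (ca ^ 2))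
  refine (h.congr_deriv ?_).congr_of_eventuallyEq (.of_forall fun x => ?_)
  · simp only [mu]
    push_cast
    ring
  · simp only [nu, Pi.add_apply, Pi.sub_apply, Pi.mul_apply, Pi.pow_apply]
    ring

theorem continuous_mu_const (cb ca cρ : ℝ) :
    Continuous (mu (fun _ => cb) (fun _ => ca) (fun _ => cρ)) := by
  unfold mu
  fun_prop

/-- The integrating factor of a logarithmic derivative `f' / f` is `f a / f b`. -/
theorem exp_neg_integral_logDeriv {f f' : ℝ → ℝ} {a b : ℝ}
    (hf : ∀ x ∈ uIcc a b, HasDerivAt f (f' x) x) (hf' : ContinuousOn f' (uIcc a b))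
    (hpos : ∀ x ∈ uIcc a b, 0 < f x) :
    Real.exp (-∫ x in a..b, f' x / f x) = f a * (1 / f b) := by
  have hcont : ContinuousOn f (uIcc a b) := fun x hx => (hf x hx).continuousAt.continuousWithinAt
  rw [intervalIntegral.integral_eq_sub_of_hasDerivAt
      (fun x hx => (hf x hx).log (hpos x hx).ne')
      (hf'.div hcont fun x hx => (hpos x hx).ne').intervalIntegrable,
    neg_sub, Real.exp_sub, Real.exp_log (hpos a left_mem_uIcc),
    Real.exp_log (hpos b right_mem_uIcc), mul_one_div]

theorem stmt_8 (σb σa ρ : ℝ → ℝ) (cb ca cρ : ℝ)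
    (hσb : σb = fun _ => cb) (hσa : σa = fun _ => ca) (hρ : ρ = fun _ => cρ)
    (u : ℝ → ℝ)
    (hu : ∀ z : ℝ, u z =
      (∫ y in (0:ℝ)..z, Real.exp (-∫ x in (0:ℝ)..y, mu σb σa ρ x / nu σb σa ρ x)) /
      (∫ y in (0:ℝ)..(1:ℝ), Real.exp (-∫ x in (0:ℝ)..y, mu σb σa ρ x / nu σb σa ρ x))) :
    (∀ z : ℝ, mu σb σa ρ z = deriv (nu σb σa ρ) z) ∧
    ((∀ z ∈ Icc (0:ℝ) 1, 0 < nu σb σa ρ z) →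
      ∀ z ∈ Icc (0:ℝ) 1,
        u z = (∫ y in (0:ℝ)..z, 1 / nu σb σa ρ y) / (∫ y in (0:ℝ)..(1:ℝ), 1 / nu σb σa ρ y)) := by
  subst hσb hσa hρ
  refine ⟨fun z => (hasDerivAt_nu_const cb ca cρ z).deriv.symm, fun hpos z hz => ?_⟩
  have key : ∀ w ∈ Icc (0:ℝ) 1,
      (∫ y in (0:ℝ)..w, Real.exp (-∫ x in (0:ℝ)..y,
        mu (fun _ => cb) (fun _ => ca) (fun _ => cρ) x /
          nu (fun _ => cb) (fun _ => ca) (fun _ => cρ) x)) =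
      nu (fun _ => cb) (fun _ => ca) (fun _ => cρ) 0 *
        ∫ y in (0:ℝ)..w, 1 / nu (fun _ => cb) (fun _ => ca) (fun _ => cρ) y := by
    intro w hw
    rw [← intervalIntegral.integral_const_mul]
    refine intervalIntegral.integral_congr fun y hy => ?_
    rw [uIcc_of_le hw.1] at hy
    refine exp_neg_integral_logDeriv (fun x _ => hasDerivAt_nu_const cb ca cρ x)
      (continuous_mu_const cb ca cρ).continuousOn fun x hx => hpos x ?_
    rw [uIcc_of_le hy.1] at hx
    exact ⟨hx.1, hx.2.trans (hy.2.trans hw.2)⟩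
  have h0 : (0:ℝ) ∈ Icc (0:ℝ) 1 := by simp
  have h1 : (1:ℝ) ∈ Icc (0:ℝ) 1 := by simp
  rw [hu z, key z hz, key 1 h1, mul_div_mul_left _ _ (hpos 0 h0).ne']
end

section
/- Let σᵇ, σᵃ, ρ : ℝ → ℝ be functions, let v : ℝ → ℝ be twice differentiable, and define u(x,y) = v(x/(x+y)) for x + y ≠ 0. Then for all x, y with x + y ≠ 0, writing z = x/(x+y): σᵇ(z)²·∂²u/∂x²(x,y) + 2·ρ(z)·σᵇ(z)·σᵃ(z)·∂²u/∂x∂y(x,y) + σᵃ(z)²·∂²u/∂y²(x,y) = (μ(z)·v'(z) + ν(z)·v''(z)) / (x+y)². In particular, u solves the PDE σᵇ(z)²·u_xx + 2ρ(z)σᵇ(z)σᵃ(z)·u_xy + σᵃ(z)²·u_yy = 0 at (x,y) if and only if μ(z)·v'(z) + ν(z)·v''(z) = 0 at z = x/(x+y). -/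
open Real Set

theorem hasDerivAt_div_add_left {x y : ℝ} (h : x + y ≠ 0) :
    HasDerivAt (fun t => t / (t + y)) (y / (x + y) ^ 2) x := by
  refine ((hasDerivAt_id x).div ((hasDerivAt_id x).add_const y) h).congr_deriv ?_
  simp

theorem hasDerivAt_div_add_right {x y : ℝ} (h : x + y ≠ 0) :
    HasDerivAt (fun t => x / (x + t)) (-x / (x + y) ^ 2) y := by
  refine ((hasDerivAt_const y x).div ((hasDerivAt_id y).const_add x) h).congr_deriv ?_
  simp

section ImbalanceDerivatives

variable {v : ℝ → ℝ} {x y : ℝ}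

theorem deriv_comp_div_add_left (hv : Differentiable ℝ v) (h : x + y ≠ 0) :
    deriv (fun t => v (t / (t + y))) x = deriv v (x / (x + y)) * (y / (x + y) ^ 2) :=
  ((hv _).hasDerivAt.comp x (hasDerivAt_div_add_left h)).deriv

theorem deriv_comp_div_add_right (hv : Differentiable ℝ v) (h : x + y ≠ 0) :
    deriv (fun t => v (x / (x + t))) y = deriv v (x / (x + y)) * (-x / (x + y) ^ 2) :=
  ((hv _).hasDerivAt.comp y (hasDerivAt_div_add_right h)).deriv

theorem eventually_add_right_ne_zero (h : x + y ≠ 0) : ∀ᶠ s in nhds x, s + y ≠ 0 :=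
  (continuous_add_const y).continuousAt.eventually_ne h

theorem eventually_add_left_ne_zero (h : x + y ≠ 0) : ∀ᶠ s in nhds y, x + s ≠ 0 :=
  (continuous_const_add x).continuousAt.eventually_ne h

theorem deriv_deriv_comp_div_add_left (hv : Differentiable ℝ v)
    (hv' : Differentiable ℝ (deriv v)) (h : x + y ≠ 0) :
    deriv (fun s => deriv (fun t => v (t / (t + y))) s) x =
      deriv (deriv v) (x / (x + y)) * (y / (x + y) ^ 2) ^ 2 +
        deriv v (x / (x + y)) * (-2 * y / (x + y) ^ 3) := by
  have hev : (fun s => deriv (fun t => v (t / (t + y))) s) =ᶠ[nhds x]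
      fun s => deriv v (s / (s + y)) * (y / (s + y) ^ 2) := by
    filter_upwards [eventually_add_right_ne_zero h] with s hs
    exact deriv_comp_div_add_left hv hs
  rw [hev.deriv_eq]
  refine (((hv' _).hasDerivAt.comp x (hasDerivAt_div_add_left h)).mul
    ((hasDerivAt_const x y).div (((hasDerivAt_id x).add_const y).pow 2)
      (pow_ne_zero 2 h))).deriv.trans ?_
  simp
  field_simp

theorem deriv_deriv_comp_div_add_mixed (hv : Differentiable ℝ v)
    (hv' : Differentiable ℝ (deriv v)) (h : x + y ≠ 0) :
    deriv (fun s => deriv (fun t => v (s / (s + t))) y) x =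
      deriv (deriv v) (x / (x + y)) * (-(x * y) / (x + y) ^ 4) +
        deriv v (x / (x + y)) * ((x - y) / (x + y) ^ 3) := by
  have hev : (fun s => deriv (fun t => v (s / (s + t))) y) =ᶠ[nhds x]
      fun s => deriv v (s / (s + y)) * (-s / (s + y) ^ 2) := by
    filter_upwards [eventually_add_right_ne_zero h] with s hs
    exact deriv_comp_div_add_right hv hs
  rw [hev.deriv_eq]
  refine (((hv' _).hasDerivAt.comp x (hasDerivAt_div_add_left h)).mul
    ((hasDerivAt_id x).neg.div (((hasDerivAt_id x).add_const y).pow 2)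
      (pow_ne_zero 2 h))).deriv.trans ?_
  simp
  field_simp
  ring

theorem deriv_deriv_comp_div_add_right (hv : Differentiable ℝ v)
    (hv' : Differentiable ℝ (deriv v)) (h : x + y ≠ 0) :
    deriv (fun s => deriv (fun t => v (x / (x + t))) s) y =
      deriv (deriv v) (x / (x + y)) * (x / (x + y) ^ 2) ^ 2 +
        deriv v (x / (x + y)) * (2 * x / (x + y) ^ 3) := by
  have hev : (fun s => deriv (fun t => v (x / (x + t))) s) =ᶠ[nhds y]
      fun s => deriv v (x / (x + s)) * (-x / (x + s) ^ 2) := by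
    filter_upwards [eventually_add_left_ne_zero h] with s hs
    exact deriv_comp_div_add_right hv hs
  rw [hev.deriv_eq]
  refine (((hv' _).hasDerivAt.comp y (hasDerivAt_div_add_right h)).mul
    ((hasDerivAt_const y (-x)).div (((hasDerivAt_id y).const_add x).pow 2)
      (pow_ne_zero 2 h))).deriv.trans ?_
  simp
  field_simp

end ImbalanceDerivatives

theorem stmt_10 (σb σa ρ : ℝ → ℝ) (v : ℝ → ℝ)
    (hv : Differentiable ℝ v) (hv' : Differentiable ℝ (deriv v))
    (x y : ℝ) (hxy : x + y ≠ 0) :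
    ((σb (x / (x + y))) ^ 2 * deriv (fun s => deriv (fun t => v (t / (t + y))) s) x
      + 2 * ρ (x / (x + y)) * σb (x / (x + y)) * σa (x / (x + y)) *
          deriv (fun s => deriv (fun t => v (s / (s + t))) y) x
      + (σa (x / (x + y))) ^ 2 * deriv (fun s => deriv (fun t => v (x / (x + t))) s) y
      = (mu σb σa ρ (x / (x + y)) * deriv v (x / (x + y))
          + nu σb σa ρ (x / (x + y)) * deriv (deriv v) (x / (x + y))) / (x + y) ^ 2) ∧
    ((σb (x / (x + y))) ^ 2 * deriv (fun s => deriv (fun t => v (t / (t + y))) s) x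
      + 2 * ρ (x / (x + y)) * σb (x / (x + y)) * σa (x / (x + y)) *
          deriv (fun s => deriv (fun t => v (s / (s + t))) y) x
      + (σa (x / (x + y))) ^ 2 * deriv (fun s => deriv (fun t => v (x / (x + t))) s) y = 0
      ↔ mu σb σa ρ (x / (x + y)) * deriv v (x / (x + y))
          + nu σb σa ρ (x / (x + y)) * deriv (deriv v) (x / (x + y)) = 0) := by
  rw [deriv_deriv_comp_div_add_left hv hv' hxy, deriv_deriv_comp_div_add_mixed hv hv' hxy,
    deriv_deriv_comp_div_add_right hv hv' hxy]
  refine and_iff_left_of_imp (fun key => ?_) |>.mpr ?_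
  · rw [key, div_eq_zero_iff, or_iff_left (pow_ne_zero 2 hxy)]
  · unfold mu nu
    generalize deriv (deriv v) (x / (x + y)) = d₂
    generalize deriv v (x / (x + y)) = d₁
    generalize σb (x / (x + y)) = b
    generalize σa (x / (x + y)) = a
    generalize ρ (x / (x + y)) = r
    field_simp
    ring
end

section
/- Suppose σᵇ, σᵃ, ρ : ℝ → ℝ are continuous on [0,1] with ν(z) > 0 for all z ∈ [0,1]. Let w : [0,1] → ℝ be twice continuously differentiable with ν(z)·w''(z) + μ(z)·w'(z) = 0 for all z ∈ [0,1], w(0) = 0 and w(1) = 1. Then w(z) = (∫₀^z exp(-∫₀^y μ(x)/ν(x) dx) dy) / (∫₀^1 exp(-∫₀^y μ(x)/ν(x) dx) dy) for all z ∈ [0,1]; in particular, the boundary value problem has a unique C² solution. -/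
open Real Set

/-- A function whose one-sided derivative within `[0, 1]` vanishes is constant on `[0, 1]`. -/
theorem eq_apply_zero_of_hasDerivWithinAt_zero {h : ℝ → ℝ}
    (hh : ∀ z ∈ Icc (0:ℝ) 1, HasDerivWithinAt h 0 (Icc 0 1) z) :
    ∀ z ∈ Icc (0:ℝ) 1, h z = h 0 :=
  constant_of_has_deriv_right_zero (fun z hz => (hh z hz).continuousWithinAt) fun z hz =>
    (hh z ⟨hz.1, hz.2.le⟩).mono_of_mem_nhdsWithin (Icc_mem_nhdsGE_of_mem hz)

theorem hasDerivAt_integral_zero {f : ℝ → ℝ} (hf : Continuous f) (z : ℝ) :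
    HasDerivAt (fun y => ∫ x in (0:ℝ)..y, f x) (f z) z :=
  intervalIntegral.integral_hasDerivAt_right (hf.intervalIntegrable _ _)
    (hf.stronglyMeasurableAtFilter _ _) hf.continuousAt

/-- Solutions of `w'' = -f w'` vanishing at `0` are multiples of `∫₀ᶻ exp (-∫₀ʸ f)`,
for `f` continuous on the line. -/
theorem eq_mul_integral_exp_of_continuous {f w w' w'' : ℝ → ℝ} (hf : Continuous f)
    (hw : ∀ z ∈ Icc (0:ℝ) 1, HasDerivWithinAt w (w' z) (Icc 0 1) z)
    (hw' : ∀ z ∈ Icc (0:ℝ) 1, HasDerivWithinAt w' (w'' z) (Icc 0 1) z)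
    (hode : ∀ z ∈ Icc (0:ℝ) 1, w'' z = -f z * w' z) (hw0 : w 0 = 0) :
    ∀ z ∈ Icc (0:ℝ) 1,
      w z = w' 0 * ∫ y in (0:ℝ)..z, Real.exp (-∫ x in (0:ℝ)..y, f x) := by
  have hF := hasDerivAt_integral_zero hf
  have hE : Continuous fun y => Real.exp (-∫ x in (0:ℝ)..y, f x) :=
    Real.continuous_exp.comp
      (continuous_iff_continuousAt.2 fun z => (hF z).continuousAt).neg
  have hw'_eq : ∀ z ∈ Icc (0:ℝ) 1, w' z = w' 0 * Real.exp (-∫ x in (0:ℝ)..z, f x) := by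
    intro z hz
    have h := eq_apply_zero_of_hasDerivWithinAt_zero
      (h := fun y => Real.exp (∫ x in (0:ℝ)..y, f x) * w' y) (fun y hy => by
        refine ((hF y).exp.hasDerivWithinAt.mul (hw' y hy)).congr_deriv ?_
        rw [hode y hy]
        ring) z hz
    simp only [intervalIntegral.integral_same, Real.exp_zero, one_mul] at h
    rw [← h, Real.exp_neg]
    field_simp
  intro z hz
  have h := eq_apply_zero_of_hasDerivWithinAt_zero
    (h := fun y => w y - w' 0 * ∫ t in (0:ℝ)..y, Real.exp (-∫ x in (0:ℝ)..t, f x))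
    (fun y hy => by
      refine ((hw y hy).sub
        ((hasDerivAt_integral_zero hE y).const_mul (w' 0)).hasDerivWithinAt).congr_deriv ?_
      rw [hw'_eq y hy, sub_self]) z hz
  simp only [intervalIntegral.integral_same, mul_zero, hw0, sub_zero] at h
  exact sub_eq_zero.1 h

/-- Solutions of `w'' = -f w'` vanishing at `0` are multiples of `∫₀ᶻ exp (-∫₀ʸ f)`. -/
theorem eq_mul_integral_exp_of_continuousOn {f w w' w'' : ℝ → ℝ}
    (hf : ContinuousOn f (Icc 0 1))
    (hw : ∀ z ∈ Icc (0:ℝ) 1, HasDerivWithinAt w (w' z) (Icc 0 1) z)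
    (hw' : ∀ z ∈ Icc (0:ℝ) 1, HasDerivWithinAt w' (w'' z) (Icc 0 1) z)
    (hode : ∀ z ∈ Icc (0:ℝ) 1, w'' z = -f z * w' z) (hw0 : w 0 = 0) :
    ∀ z ∈ Icc (0:ℝ) 1,
      w z = w' 0 * ∫ y in (0:ℝ)..z, Real.exp (-∫ x in (0:ℝ)..y, f x) := by
  set g : ℝ → ℝ := IccExtend (zero_le_one' ℝ) ((Icc 0 1).domRestrict f)
  have hgf : ∀ x ∈ Icc (0:ℝ) 1, g x = f x := fun x hx => IccExtend_of_mem _ _ hx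
  have hg : Continuous g := hf.domRestrict.Icc_extend'
  have hsub : ∀ {z : ℝ}, z ∈ Icc (0:ℝ) 1 → uIcc 0 z ⊆ Icc 0 1 := fun hz =>
    uIcc_subset_Icc (left_mem_Icc.2 zero_le_one) hz
  intro z hz
  rw [eq_mul_integral_exp_of_continuous hg hw hw'
    (fun y hy => by rw [hgf y hy, hode y hy]) hw0 z hz]
  congr 1
  refine intervalIntegral.integral_congr fun y hy => ?_
  have h : ∫ x in (0:ℝ)..y, g x = ∫ x in (0:ℝ)..y, f x :=
    intervalIntegral.integral_congr fun x hx => hgf x (hsub (hsub hz hy) hx)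
  simp only [h]

theorem stmt_12 (σb σa ρ : ℝ → ℝ)
    (hσb : ContinuousOn σb (Icc 0 1))
    (hσa : ContinuousOn σa (Icc 0 1))
    (hρ : ContinuousOn ρ (Icc 0 1))
    (hν : ∀ z ∈ Icc (0:ℝ) 1, 0 < nu σb σa ρ z)
    (w w' w'' : ℝ → ℝ)
    (hw : ∀ z ∈ Icc (0:ℝ) 1, HasDerivWithinAt w (w' z) (Icc 0 1) z)
    (hw' : ∀ z ∈ Icc (0:ℝ) 1, HasDerivWithinAt w' (w'' z) (Icc 0 1) z)
    (hw''c : ContinuousOn w'' (Icc 0 1))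
    (hode : ∀ z ∈ Icc (0:ℝ) 1, nu σb σa ρ z * w'' z + mu σb σa ρ z * w' z = 0)
    (hw0 : w 0 = 0) (hw1 : w 1 = 1) :
    ∀ z ∈ Icc (0:ℝ) 1,
      w z = (∫ y in (0:ℝ)..z, Real.exp (-∫ x in (0:ℝ)..y, mu σb σa ρ x / nu σb σa ρ x)) /
            (∫ y in (0:ℝ)..(1:ℝ), Real.exp (-∫ x in (0:ℝ)..y, mu σb σa ρ x / nu σb σa ρ x)) := by
  have hμc : ContinuousOn (mu σb σa ρ) (Icc 0 1) := by
    unfold mu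
    fun_prop
  have hνc : ContinuousOn (nu σb σa ρ) (Icc 0 1) := by
    unfold nu
    fun_prop
  have key := eq_mul_integral_exp_of_continuousOn
    (hμc.div hνc fun z hz => (hν z hz).ne') hw hw'
    (fun z hz => by
      have := (hν z hz).ne'
      simp only [Pi.div_apply]
      field_simp
      linarith [hode z hz]) hw0
  simp only [Pi.div_apply] at key
  have h1 := key 1 (right_mem_Icc.2 zero_le_one)
  rw [hw1] at h1
  intro z hz
  rw [key z hz, eq_div_iff (right_ne_zero_of_mul (h1 ▸ one_ne_zero)), mul_right_comm, ← h1, one_mul]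
end

section
/- Let λ¹, λ², λ³, λ⁴, λ⁵, λ⁶ ≥ 0 be real numbers satisfying the driftless condition λ¹ - λ² = λ⁶ - λ⁵ = λ⁴ - λ³. Let f : ℝ² → ℝ be twice continuously differentiable and fix (x,y) ∈ ℝ². For each n ≥ 1 define Lₙf(x,y) = n·[λ¹·(f(x+n^{-1/2},y) - f(x,y)) + λ²·(f(x-n^{-1/2},y) - f(x,y)) + λ³·(f(x,y+n^{-1/2}) - f(x,y)) + λ⁴·(f(x,y-n^{-1/2}) - f(x,y)) + λ⁵·(f(x+n^{-1/2},y-n^{-1/2}) - f(x,y)) + λ⁶·(f(x-n^{-1/2},y+n^{-1/2}) - f(x,y))]. Then as n → ∞, Lₙf(x,y) converges to (1/2)·(λ¹+λ²+λ⁵+λ⁶)·∂²f/∂x²(x,y) + (1/2)·(λ³+λ⁴+λ⁵+λ⁶)·∂²f/∂y²(x,y) - (λ⁵+λ⁶)·∂²f/∂x∂y(x,y). -/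
open Real Set Filter

section SecondOrderExpansion

variable {E : Type*} [NormedAddCommGroup E] [NormedSpace ℝ E] {f : E → ℝ}

theorem hasDerivAt_line (hf : Differentiable ℝ f) (p v : E) (t : ℝ) :
    HasDerivAt (fun s : ℝ => f (p + s • v)) (fderiv ℝ f (p + t • v) v) t := by
  have hline : HasDerivAt (fun s : ℝ => p + s • v) v t := by
    simpa using ((hasDerivAt_id t).smul_const v).const_add p
  exact (hf _).hasFDerivAt.comp_hasDerivAt t hline

theorem hasDerivAt_fderiv_line (hf : ContDiff ℝ 2 f) (p v w : E) (t : ℝ) :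
    HasDerivAt (fun s : ℝ => fderiv ℝ f (p + s • v) w)
      (fderiv ℝ (fderiv ℝ f) (p + t • v) v w) t := by
  have hline : HasDerivAt (fun s : ℝ => p + s • v) v t := by
    simpa using ((hasDerivAt_id t).smul_const v).const_add p
  have hdf : Differentiable ℝ (fderiv ℝ f) :=
    (hf.fderiv_right (m := 1) (by norm_num)).differentiable (by norm_num)
  have h := (hdf (p + t • v)).hasFDerivAt.comp_hasDerivAt t hline
  simpa using h.clm_apply (hasDerivAt_const t w)

theorem tendsto_second_order_line (hf : ContDiff ℝ 2 f) (p v : E) :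
    Tendsto (fun h : ℝ => (f (p + h • v) - f p - h * fderiv ℝ f p v) / h ^ 2)
      (nhdsWithin 0 {0}ᶜ) (nhds (1 / 2 * fderiv ℝ (fderiv ℝ f) p v v)) := by
  have hd : Differentiable ℝ f := hf.differentiable (by norm_num)
  have hg : ContDiff ℝ 2 (fun s : ℝ => f (p + s • v)) := by fun_prop
  have hderiv : deriv (fun s : ℝ => f (p + s • v)) = fun t => fderiv ℝ f (p + t • v) v :=
    funext fun t => (hasDerivAt_line hd p v t).deriv
  have hderiv2 : iteratedDeriv 2 (fun s : ℝ => f (p + s • v)) 0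
      = fderiv ℝ (fderiv ℝ f) p v v := by
    rw [iteratedDeriv_succ, iteratedDeriv_one, hderiv,
      (hasDerivAt_fderiv_line hf p v v 0).deriv]
    simp
  have ht := (taylor_isLittleO_univ (x₀ := 0) (n := 2) hg).tendsto_div_nhds_zero
  have ht' := (ht.mono_left (nhdsWithin_le_nhds (s := {0}ᶜ))).add_const
    (1 / 2 * fderiv ℝ (fderiv ℝ f) p v v)
  rw [zero_add] at ht'
  refine ht'.congr' ?_
  filter_upwards [self_mem_nhdsWithin] with h hh
  have hh : h ≠ 0 := hh
  simp only [taylorWithinEval_succ, taylor_within_zero_eval, iteratedDerivWithin_univ, zero_add,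
    Nat.reduceAdd, hderiv2, iteratedDeriv_one, hderiv]
  simp
  field_simp
  ring

theorem tendsto_scaled_increment (hf : ContDiff ℝ 2 f) (p v : E) :
    Tendsto (fun n : ℕ => (n : ℝ) *
        (f (p + (1 / Real.sqrt n) • v) - f p - 1 / Real.sqrt n * fderiv ℝ f p v))
      atTop (nhds (1 / 2 * fderiv ℝ (fderiv ℝ f) p v v)) := by
  have hstep : Tendsto (fun n : ℕ => 1 / Real.sqrt n) atTop (nhdsWithin 0 {0}ᶜ) := by
    refine tendsto_nhdsWithin_iff.2 ⟨?_, ?_⟩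
    · simp only [one_div]
      exact (Real.tendsto_sqrt_atTop.comp tendsto_natCast_atTop_atTop).inv_tendsto_atTop
    · filter_upwards [eventually_gt_atTop 0] with n hn
      have : 0 < Real.sqrt n := Real.sqrt_pos.2 (by exact_mod_cast hn)
      exact (one_div_pos.2 this).ne'
  refine ((tendsto_second_order_line hf p v).comp hstep).congr fun n => ?_
  simp only [Function.comp, div_pow, one_pow, Real.sq_sqrt (Nat.cast_nonneg n), div_div_eq_mul_div,
    div_one]
  ring

end SecondOrderExpansion

theorem stmt_13 (l1 l2 l3 l4 l5 l6 : ℝ)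
    (h1 : 0 ≤ l1) (h2 : 0 ≤ l2) (h3 : 0 ≤ l3) (h4 : 0 ≤ l4) (h5 : 0 ≤ l5) (h6 : 0 ≤ l6)
    (hdrift1 : l1 - l2 = l6 - l5) (hdrift2 : l6 - l5 = l4 - l3)
    (f : ℝ × ℝ → ℝ) (hf : ContDiff ℝ 2 f) (x y : ℝ) :
    Tendsto (fun n : ℕ =>
      (n : ℝ) * (l1 * (f (x + 1 / Real.sqrt n, y) - f (x, y))
        + l2 * (f (x - 1 / Real.sqrt n, y) - f (x, y))
        + l3 * (f (x, y + 1 / Real.sqrt n) - f (x, y))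
        + l4 * (f (x, y - 1 / Real.sqrt n) - f (x, y))
        + l5 * (f (x + 1 / Real.sqrt n, y - 1 / Real.sqrt n) - f (x, y))
        + l6 * (f (x - 1 / Real.sqrt n, y + 1 / Real.sqrt n) - f (x, y))))
      atTop
      (nhds ((1 / 2) * (l1 + l2 + l5 + l6) * deriv (fun s => deriv (fun t => f (t, y)) s) x
        + (1 / 2) * (l3 + l4 + l5 + l6) * deriv (fun s => deriv (fun t => f (x, t)) s) y
        - (l5 + l6) * deriv (fun s => deriv (fun t => f (s, t)) y) x)) := by
  have hd : Differentiable ℝ f := hf.differentiable (by norm_num)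
  have hx (s b : ℝ) : deriv (fun t => f (t, b)) s = fderiv ℝ f (s, b) (1, 0) := by
    simpa using (hasDerivAt_line hd (0, b) (1, 0) s).deriv
  have hy (a s : ℝ) : deriv (fun t => f (a, t)) s = fderiv ℝ f (a, s) (0, 1) := by
    simpa using (hasDerivAt_line hd (a, 0) (0, 1) s).deriv
  have hxx : deriv (fun s => fderiv ℝ f (s, y) (1, 0)) x
      = fderiv ℝ (fderiv ℝ f) (x, y) (1, 0) (1, 0) := by
    simpa using (hasDerivAt_fderiv_line hf (0, y) (1, 0) (1, 0) x).deriv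
  have hyy : deriv (fun s => fderiv ℝ f (x, s) (0, 1)) y
      = fderiv ℝ (fderiv ℝ f) (x, y) (0, 1) (0, 1) := by
    simpa using (hasDerivAt_fderiv_line hf (x, 0) (0, 1) (0, 1) y).deriv
  have hxy : deriv (fun s => fderiv ℝ f (s, y) (0, 1)) x
      = fderiv ℝ (fderiv ℝ f) (x, y) (1, 0) (0, 1) := by
    simpa using (hasDerivAt_fderiv_line hf (0, y) (1, 0) (0, 1) x).deriv
  have hsymm : fderiv ℝ (fderiv ℝ f) (x, y) (0, 1) (1, 0)
      = fderiv ℝ (fderiv ℝ f) (x, y) (1, 0) (0, 1) :=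
    (hf.contDiffAt.isSymmSndFDerivAt (by simp)) (0, 1) (1, 0)
  simp only [hx, hy, hxx, hyy, hxy]
  have key (v : ℝ × ℝ) := tendsto_scaled_increment hf (x, y) v
  have e2 : ((-1, 0) : ℝ × ℝ) = -(1, 0) := by simp
  have e4 : ((0, -1) : ℝ × ℝ) = -(0, 1) := by simp
  have e5 : ((1, -1) : ℝ × ℝ) = (1, 0) - (0, 1) := by simp
  have e6 : ((-1, 1) : ℝ × ℝ) = (0, 1) - (1, 0) := by simp
  have hsum := ((((((key (1, 0)).const_mul l1).add ((key (-1, 0)).const_mul l2)).add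
    ((key (0, 1)).const_mul l3)).add ((key (0, -1)).const_mul l4)).add
    ((key (1, -1)).const_mul l5)).add ((key (-1, 1)).const_mul l6)
  convert hsum using 1
  · funext n
    have hp (a b : ℝ) : (x, y) + (1 / Real.sqrt n) • ((a, b) : ℝ × ℝ)
        = (x + 1 / Real.sqrt n * a, y + 1 / Real.sqrt n * b) := by simp
    simp only [hp, mul_one, mul_zero, mul_neg, add_zero, ← sub_eq_add_neg]
    simp only [e2, e4, e5, e6, map_neg, map_sub]
    obtain rfl : l1 = l2 + l6 - l5 := by linarith
    obtain rfl : l4 = l3 + l6 - l5 := by linarith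
    ring
  · simp only [e2, e4, e5, e6, map_neg, map_sub, neg_apply,
      sub_apply, hsymm]
    ring_nf
end
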